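/- Let O_m, O_n, ν be Pauli strings on N qubits. If Tr(O_nᴴ [O_m, ν]) ≠ 0, then also Tr(O_mᴴ [O_n, ν]) ≠ 0. Equivalently, if [O_m, ν] ≠ 0 and ⌊O_m, ν⌉ = O_n, then [O_n, ν] ≠ 0 and ⌊O_n, ν⌉ = O_m; so every edge of the graph associated with an accessible set is bi-directed, i.e., the graph is undirected. -/

import Mathlib

open Matrix Complex Kronecker
open scoped Classical

noncomputable section

/-- The state/operator space of an `N`-qubit system, indexed by bit strings. -/
abbrev Mat (N : ℕ) := Matrix (Fin N → Fin 2) (Fin N → Fin 2) ℂ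

/-- The four Pauli matrices: σ₀ = I, σ₁ = X, σ₂ = Y, σ₃ = Z. -/
def pauli (a : Fin 4) : Matrix (Fin 2) (Fin 2) ℂ :=
  if a = 0 then 1
  else if a = 1 then !![0, 1; 1, 0]
  else if a = 2 then !![0, -Complex.I; Complex.I, 0]
  else !![1, 0; 0, -1]

/-- The Pauli string σ_{s 1} ⊗ σ_{s 2} ⊗ ⋯ ⊗ σ_{s N}, realized entrywise. -/
def pauliString {N : ℕ} (s : Fin N → Fin 4) : Mat N :=
  fun i j => ∏ k, pauli (s k) (i k) (j k)

/-- Ω : the set of all Pauli strings on `N` qubits. -/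
def Omega (N : ℕ) : Set (Mat N) := Set.range pauliString

/-- The commutator [A,B] = AB − BA. -/
def mcomm {n : Type*} [Fintype n] (A B : Matrix n n ℂ) : Matrix n n ℂ := A * B - B * A

/-- ⌊A,B⌉ : the unique Pauli string which is a nonzero scalar multiple of [A,B];
it is 0 when no such Pauli string exists (in particular when [A,B] = 0). -/
def pbracket {N : ℕ} (A B : Mat N) : Mat N :=
  if h : ∃ s : Fin N → Fin 4, ∃ c : ℂ, c ≠ 0 ∧ mcomm A B = c • pauliString s
  then pauliString h.choose else 0

/-- The accessible set f(Ω, F, M) : the smallest set containing M and closed under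
adding ⌊τ,ν⌉ for τ already accessible, ν ∈ F with [τ,ν] ≠ 0. -/
inductive Accessible {N : ℕ} (F M : Set (Mat N)) : Mat N → Prop
  | base {O : Mat N} : O ∈ M → Accessible F M O
  | step {τ ν : Mat N} : Accessible F M τ → ν ∈ F → mcomm τ ν ≠ 0 →
      Accessible F M (pbracket τ ν)

/-- The accessible set, as a set. -/
def accSet {N : ℕ} (F M : Set (Mat N)) : Set (Mat N) := {O | Accessible F M O}

/-- Adjacency in the graph with vertex set S, relative to the Hamiltonian set F:
distinct vertices O_m, O_n are adjacent iff Tr(O_nᴴ [O_m, ν]) ≠ 0 for some ν ∈ F. -/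
def Adj {N : ℕ} (F S : Set (Mat N)) (A B : Mat N) : Prop :=
  A ∈ S ∧ B ∈ S ∧ A ≠ B ∧ ∃ ν ∈ F, (Bᴴ * mcomm A ν).trace ≠ 0

/-- Connectivity of the graph on vertex set S: any two vertices are joined by a path. -/
def GraphConnected {N : ℕ} (F S : Set (Mat N)) : Prop :=
  ∀ A ∈ S, ∀ B ∈ S, Relation.ReflTransGen (Adj F S) A B

/-- Index string with value `a` at 0-indexed positions k and k+1, identity elsewhere. -/
def twoSite (N k : ℕ) (a : Fin 4) : Fin N → Fin 4 :=
  fun j => if (j : ℕ) = k ∨ (j : ℕ) = k + 1 then a else 0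

/-- Chain Hamiltonian set F̄_K = {X_jX_{j+1}, Y_jY_{j+1} : 1 ≤ j ≤ K−1 } (1-indexed),
i.e., couplings on 0-indexed positions (t, t+1) with t+1 < K. -/
def chainFk (N K : ℕ) : Set (Mat N) :=
  {O | ∃ t : ℕ, t + 1 < K ∧
    (O = pauliString (twoSite N t 1) ∨ O = pauliString (twoSite N t 2))}

/-- The full chain Hamiltonian set on N qubits. -/
def chainF (N : ℕ) : Set (Mat N) := chainFk N N

/-- Single-site Pauli string: `a` at 0-indexed position k, identity elsewhere. -/
def singleSite (N k : ℕ) (a : Fin 4) : Fin N → Fin 4 :=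
  fun j => if (j : ℕ) = k then a else 0

/-- Z on 0-indexed positions 0,…,m−1, `a` at position m, identity elsewhere. -/
def zTail (N m : ℕ) (a : Fin 4) : Fin N → Fin 4 :=
  fun j => if (j : ℕ) < m then 3 else if (j : ℕ) = m then a else 0

/-- A Pauli string is k-finite (k is 1-indexed) when its k-th factor is not the
identity and all factors beyond position k are the identity. -/
def kFinite {N : ℕ} (k : ℕ) (O : Mat N) : Prop :=
  ∃ s : Fin N → Fin 4, O = pauliString s ∧
    (∀ j : Fin N, (j : ℕ) + 1 = k → s j ≠ 0) ∧
    (∀ j : Fin N, k ≤ (j : ℕ) → s j = 0)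

/-- Path along an edging sequence E: iteratively applying O ↦ ⌊O,ν⌉ along E has
every intermediate commutator nonzero and ends at the indicated operator. -/
def IsPath {N : ℕ} : Mat N → List (Mat N) → Mat N → Prop
  | A, [], B => A = B
  | A, n :: E, B => mcomm A n ≠ 0 ∧ IsPath (pbracket A n) E B

/-- G_{⌊k} : equal to G_1 when k = 1 and to G_k \ G_{k−1} when k > 1. -/
def Gfloor {N : ℕ} (M : Set (Mat N)) (k : ℕ) : Set (Mat N) :=
  if k = 1 then accSet (chainFk N 1) M
  else accSet (chainFk N k) M \ accSet (chainFk N (k - 1)) M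

/-- G¹_{⌊k+1} : the operators in G_{⌊k+1} adjacent, in the graph of G_{k+1},
to some element of G_k. -/
def G1floor {N : ℕ} (M : Set (Mat N)) (k : ℕ) : Set (Mat N) :=
  {O | O ∈ Gfloor M (k + 1) ∧
    ∃ P ∈ accSet (chainFk N k) M,
      Adj (chainFk N (k + 1)) (accSet (chainFk N (k + 1)) M) P O}

/-- The Kronecker product of a family of `2 × 2` matrices, realized entrywise. -/
def piKronecker {N : ℕ} (f : Fin N → Matrix (Fin 2) (Fin 2) ℂ) : Mat N :=
  Matrix.of fun i j => ∏ k, f k (i k) (j k)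

theorem piKronecker_apply {N : ℕ} (f : Fin N → Matrix (Fin 2) (Fin 2) ℂ) (i j : Fin N → Fin 2) :
    piKronecker f i j = ∏ k, f k (i k) (j k) := rfl

theorem pauliString_eq_piKronecker {N : ℕ} (s : Fin N → Fin 4) :
    pauliString s = piKronecker fun k => pauli (s k) := rfl

theorem piKronecker_mul {N : ℕ} (f g : Fin N → Matrix (Fin 2) (Fin 2) ℂ) :
    piKronecker f * piKronecker g = piKronecker fun k => f k * g k := by
  ext i j
  simp only [Matrix.mul_apply, piKronecker_apply, Finset.prod_univ_sum, Fintype.piFinset_univ,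
    Finset.prod_mul_distrib]

theorem trace_piKronecker {N : ℕ} (f : Fin N → Matrix (Fin 2) (Fin 2) ℂ) :
    (piKronecker f).trace = ∏ k, (f k).trace := by
  simp only [Matrix.trace, Matrix.diag_apply, piKronecker_apply, Finset.prod_univ_sum,
    Fintype.piFinset_univ]

theorem pauli_conjTranspose (a : Fin 4) : (pauli a)ᴴ = pauli a := by
  fin_cases a <;> ext i j <;> fin_cases i <;> fin_cases j <;> simp [pauli]

theorem pauli_mul_self (a : Fin 4) : pauli a * pauli a = 1 := by
  fin_cases a <;> ext i j <;> fin_cases i <;> fin_cases j <;> simp [pauli]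

theorem pauli_mul_comm_sign (a b : Fin 4) :
    ∃ e : ℂ, (e = 1 ∨ e = -1) ∧ pauli a * pauli b = e • (pauli b * pauli a) := by
  by_cases h : a = 0 ∨ b = 0 ∨ a = b
  · refine ⟨1, .inl rfl, ?_⟩
    rcases h with rfl | rfl | rfl <;> simp [pauli]
  · refine ⟨-1, .inr rfl, ?_⟩
    fin_cases a <;> fin_cases b <;> simp_all [pauli]

theorem trace_pauli_mul_of_ne {a b : Fin 4} (h : a ≠ b) : (pauli a * pauli b).trace = 0 := by
  fin_cases a <;> fin_cases b <;> simp_all [pauli, Matrix.trace_fin_two]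

theorem pauliString_conjTranspose {N : ℕ} (s : Fin N → Fin 4) :
    (pauliString s)ᴴ = pauliString s := by
  ext i j
  simp only [Matrix.conjTranspose_apply, pauliString, star_prod]
  refine Finset.prod_congr rfl fun k _ => ?_
  rw [← Matrix.conjTranspose_apply, pauli_conjTranspose]

theorem pauliString_mul_self {N : ℕ} (s : Fin N → Fin 4) :
    pauliString s * pauliString s = 1 := by
  rw [pauliString_eq_piKronecker, piKronecker_mul]
  ext i j
  simp only [pauli_mul_self, piKronecker_apply, Matrix.one_apply, Finset.prod_boole, funext_iff, Finset.mem_univ,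
    true_implies]

theorem pauliString_ne_zero {N : ℕ} (s : Fin N → Fin 4) : pauliString s ≠ 0 := fun h => by
  simpa [h] using pauliString_mul_self s

theorem pauliString_commute_or_anticommute {N : ℕ} (s t : Fin N → Fin 4) :
    pauliString s * pauliString t = pauliString t * pauliString s ∨
      pauliString s * pauliString t = -(pauliString t * pauliString s) := by
  choose e he h using fun k => pauli_mul_comm_sign (s k) (t k)
  have hmul : pauliString s * pauliString t = (∏ k, e k) • (pauliString t * pauliString s) := by
    simp only [pauliString_eq_piKronecker, piKronecker_mul]
    ext i j
    simp only [h, piKronecker_apply, Matrix.smul_apply, smul_eq_mul, Finset.prod_mul_distrib]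
  have hsign : (∏ k, e k) = 1 ∨ (∏ k, e k) = -1 := by
    rw [← sq_eq_one_iff, ← Finset.prod_pow]
    exact Finset.prod_eq_one fun k _ => sq_eq_one_iff.mpr (he k)
  rcases hsign with hs | hs <;> simp [hmul, hs]

/-- Proportional Pauli strings are equal. -/
theorem pauliString_eq_of_smul_eq {N : ℕ} {s t : Fin N → Fin 4} {c d : ℂ} (hc : c ≠ 0)
    (h : c • pauliString s = d • pauliString t) : s = t := by
  by_contra hne
  obtain ⟨k, hk⟩ := Function.ne_iff.mp hne
  have horth : (pauliString s * pauliString t).trace = 0 := by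
    rw [pauliString_eq_piKronecker, pauliString_eq_piKronecker, piKronecker_mul,
      trace_piKronecker]
    exact Finset.prod_eq_zero (Finset.mem_univ k) (trace_pauli_mul_of_ne hk)
  have htr := congrArg (fun A => (pauliString s * A).trace) h
  simp [pauliString_mul_self, horth, hc] at htr

theorem pbracket_spec {N : ℕ} {A B : Mat N} {s : Fin N → Fin 4}
    (h : pbracket A B = pauliString s) : ∃ c : ℂ, c ≠ 0 ∧ mcomm A B = c • pauliString s := by
  unfold pbracket at h
  split_ifs at h with hex
  · exact h ▸ hex.choose_spec
  · exact absurd h.symm (pauliString_ne_zero s)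

theorem pbracket_eq {N : ℕ} {A B : Mat N} {s : Fin N → Fin 4} {c : ℂ} (hc : c ≠ 0)
    (h : mcomm A B = c • pauliString s) : pbracket A B = pauliString s := by
  have hex : ∃ s : Fin N → Fin 4, ∃ c : ℂ, c ≠ 0 ∧ mcomm A B = c • pauliString s := ⟨s, c, hc, h⟩
  obtain ⟨d, -, hd⟩ := hex.choose_spec
  rw [pbracket, dif_pos hex, pauliString_eq_of_smul_eq hc (h.symm.trans hd)]

theorem trace_mul_mcomm_swap {n : Type*} [Fintype n] (A B C : Matrix n n ℂ) :
    (A * mcomm B C).trace = -(B * mcomm A C).trace := by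
  simp only [mcomm, mul_sub, Matrix.trace_sub, ← mul_assoc]
  rw [Matrix.trace_mul_cycle B A C, Matrix.trace_mul_cycle B C A,
    Matrix.trace_mul_comm (C * B) A, ← mul_assoc]
  ring

/-- Commuting twice with an involution that anticommutes with `A` multiplies `A` by four. -/
theorem mcomm_mcomm_of_anticommute {n : Type*} [Fintype n] [DecidableEq n] {A B : Matrix n n ℂ}
    (hAB : A * B = -(B * A)) (hB : B * B = 1) : mcomm (mcomm A B) B = (4 : ℂ) • A := by
  have hBA : B * A = -(A * B) := by rw [hAB, neg_neg]
  have hABB : A * B * B = A := by rw [mul_assoc, hB, mul_one]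
  have hBAB : B * (A * B) = -A := by rw [← mul_assoc, hBA, neg_mul, hABB]
  simp only [mcomm, hBA, sub_neg_eq_add, add_mul, mul_add, hABB, hBAB]
  module

theorem stmt_3 {N : ℕ} (Om On ν : Mat N) (h1 : Om ∈ Omega N) (h2 : On ∈ Omega N)
    (h3 : ν ∈ Omega N) :
    ((Onᴴ * mcomm Om ν).trace ≠ 0 → (Omᴴ * mcomm On ν).trace ≠ 0) ∧
    (mcomm Om ν ≠ 0 → pbracket Om ν = On →
      mcomm On ν ≠ 0 ∧ pbracket On ν = Om) := by
  obtain ⟨m, rfl⟩ := h1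
  obtain ⟨n, rfl⟩ := h2
  obtain ⟨v, rfl⟩ := h3
  refine ⟨fun h => ?_, fun hne hbr => ?_⟩
  · rw [pauliString_conjTranspose] at h ⊢
    rwa [trace_mul_mcomm_swap, neg_ne_zero] at h
  · obtain ⟨c, hc, hcomm⟩ := pbracket_spec hbr
    have hanti := (pauliString_commute_or_anticommute m v).resolve_left
      fun h => hne (sub_eq_zero.mpr h)
    have htwice := mcomm_mcomm_of_anticommute hanti (pauliString_mul_self v)
    have hsmul : mcomm (c • pauliString n) (pauliString v) =
        c • mcomm (pauliString n) (pauliString v) := by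
      simp [mcomm, smul_sub]
    rw [hcomm, hsmul] at htwice
    have hback : mcomm (pauliString n) (pauliString v) = (c⁻¹ * 4) • pauliString m := by
      rw [mul_smul, ← htwice, inv_smul_smul₀ hc]
    have hc4 : c⁻¹ * 4 ≠ 0 := by simp [hc]
    exact ⟨hback ▸ smul_ne_zero hc4 (pauliString_ne_zero m), pbracket_eq hc4 hback⟩
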